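/- Let E and F be finite-dimensional real inner product spaces and 0 < c ≤ C. For each s ≥ 0 let V_s : E × F → ℝ satisfy c(1 + cs)^{−1} I_E ⊕ c I_F ≤ HV_s ≤ C(1 + Cs)^{−1} I_E ⊕ C I_F, and for s, t ∈ [0, ∞) let F_{s,t} : E × F → E satisfy F_{t,t}(x, y) = x and ∂_s F_{s,t}(x, y) = (1/2) ∇_x V_s(F_{s,t}(x, y), y). Define the renormalized maps F̃_{s,t}(x, y) = e^{−s/2} F_{e^s − 1, e^t − 1}(e^{t/2} x, y) for s, t ∈ [0, ∞). Then for all s, t: (i) ‖F̃_{s,t}‖_{Lip,dx} ≤ max(C, 1/c)^{1/2}; (ii) ‖F̃_{s,t}‖_{Lip,dy} ≤ (C/c − 1) max(C, 1/C)^{3/2} |e^{−s/2} − e^{−t/2}|; (iii) ‖F̃_{s,t}‖_{Lip} ≤ max(C, 1/c)^{7/2}. -/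

import Mathlib

open Set

/-- A convex function on a finite-dimensional space has a subgradient at every point. -/
theorem ConvexOn.exists_subgradient {G : Type*} [NormedAddCommGroup G] [NormedSpace ℝ G]
    [FiniteDimensional ℝ G] {f : G → ℝ} (hf : ConvexOn ℝ univ f) (z : G) :
    ∃ L : StrongDual ℝ G, ∀ w, f z + L w ≤ f (z + w) := by
  have hcont : Continuous f := hf.locallyLipschitz.continuous
  have hopen : IsOpen {p : G × ℝ | p.1 ∈ univ ∧ f p.1 < p.2} := by
    simpa using isOpen_lt (hcont.comp continuous_fst) continuous_snd
  obtain ⟨ℓ, hℓ⟩ := geometric_hahn_banach_point_open (x := (z, f z))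
    hf.convex_strict_epigraph hopen (by simp)
  have hsplit : ∀ (w : G) (r : ℝ), ℓ (w, r) = ℓ (w, 0) + r * ℓ (0, 1) := fun w r => by
    have : (w, r) = (w, (0 : ℝ)) + r • ((0 : G), (1 : ℝ)) := by simp
    rw [this, map_add, map_smul, smul_eq_mul]
  have hpos : 0 < ℓ (0, 1) := by
    have := hℓ (z, f z + 1) (by simp)
    rw [hsplit, hsplit z (f z + 1)] at this
    linarith
  refine ⟨-(ℓ (0, 1))⁻¹ • ℓ.comp (ContinuousLinearMap.inl ℝ G ℝ), fun w => ?_⟩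
  refine le_of_forall_pos_le_add fun ε hε => ?_
  have h := hℓ (z + w, f (z + w) + ε) (by simpa using hε)
  rw [hsplit, hsplit (z + w)] at h
  have hzw : ℓ (z + w, 0) = ℓ (z, 0) + ℓ (w, 0) := by rw [← map_add]; simp
  rw [hzw] at h
  have : (ℓ (0, 1))⁻¹ * ℓ (w, 0) > f z - (f (z + w) + ε) := by
    rw [gt_iff_lt, inv_mul_eq_div, lt_div_iff₀ hpos]
    linarith
  simp only [smul_apply, ContinuousLinearMap.comp_apply,
    ContinuousLinearMap.inl_apply, smul_eq_mul, neg_mul]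
  linarith

section Gradient

variable {E F : Type*}
  [NormedAddCommGroup E] [InnerProductSpace ℝ E] [FiniteDimensional ℝ E]
  [NormedAddCommGroup F] [InnerProductSpace ℝ F] [FiniteDimensional ℝ F]

/-- A function on a product whose Hessian is bounded on both sides by block-scalar forms has, at
each point, a linear form making it lie between two quadratic polynomials. -/
theorem exists_quadratic_sandwich {v : E × F → ℝ} {α α' β β' : ℝ}
    (hconv : ConvexOn ℝ univ fun p : E × F => v p - α * ‖p.1‖ ^ 2 - α' * ‖p.2‖ ^ 2)
    (hconc : ConcaveOn ℝ univ fun p : E × F => v p - β * ‖p.1‖ ^ 2 - β' * ‖p.2‖ ^ 2)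
    (z : E × F) :
    ∃ L : StrongDual ℝ (E × F), ∀ w,
      v z + L w + α * ‖w.1‖ ^ 2 + α' * ‖w.2‖ ^ 2 ≤ v (z + w) ∧
      v (z + w) ≤ v z + L w + β * ‖w.1‖ ^ 2 + β' * ‖w.2‖ ^ 2 := by
  obtain ⟨L₁, hL₁⟩ := hconv.exists_subgradient z
  obtain ⟨L₂, hL₂⟩ := hconc.neg.exists_subgradient z
  let J : ℝ → ℝ → StrongDual ℝ (E × F) := fun a a' =>
    (2 * a) • (innerSL ℝ z.1).comp (ContinuousLinearMap.fst ℝ E F) +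
      (2 * a') • (innerSL ℝ z.2).comp (ContinuousLinearMap.snd ℝ E F)
  have hJ : ∀ a a' w, J a a' w = 2 * a * inner ℝ z.1 w.1 + 2 * a' * inner ℝ z.2 w.2 := by
    intro a a' w
    simp [J]
  have lower : ∀ w, v z + (L₁ + J α α') w + α * ‖w.1‖ ^ 2 + α' * ‖w.2‖ ^ 2 ≤ v (z + w) := by
    intro w
    have h := hL₁ w
    simp only [Prod.fst_add, Prod.snd_add, norm_add_sq_real] at h
    rw [add_apply, hJ]
    linarith
  have upper : ∀ w, v (z + w) ≤ v z + (-L₂ + J β β') w + β * ‖w.1‖ ^ 2 + β' * ‖w.2‖ ^ 2 := by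
    intro w
    have h := hL₂ w
    simp only [Pi.neg_apply, Prod.fst_add, Prod.snd_add, norm_add_sq_real] at h
    rw [add_apply, hJ, neg_apply]
    linarith
  have heq : L₁ + J α α' = -L₂ + J β β' := by
    have key : ∀ w, (L₁ + J α α') w ≤ (-L₂ + J β β') w := by
      intro w
      by_contra! hlt
      set d := (L₁ + J α α') w - (-L₂ + J β β') w with hd
      set K := (β - α) * ‖w.1‖ ^ 2 + (β' - α') * ‖w.2‖ ^ 2 with hK
      have hd0 : 0 < d := sub_pos.2 hlt
      have hineq : ∀ r : ℝ, r * d ≤ r ^ 2 * K := by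
        intro r
        have h₁ := lower (r • w)
        have h₂ := upper (r • w)
        simp only [Prod.smul_fst, Prod.smul_snd, norm_smul, mul_pow, Real.norm_eq_abs, sq_abs,
          map_smul, smul_eq_mul] at h₁ h₂
        rw [hd, hK]
        linarith
      have h := hineq (d / (|K| + d))
      have hden : 0 < |K| + d := by positivity
      rw [div_pow, div_mul_eq_mul_div, div_mul_eq_mul_div,
        div_le_div_iff₀ hden (by positivity)] at h
      have hd3 : 0 < d ^ 2 * (|K| + d) := by positivity
      nlinarith [le_abs_self K, mul_pos hd3 hd0,
        mul_le_mul_of_nonneg_left (le_abs_self K) hd3.le]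
    refine ContinuousLinearMap.ext fun w => le_antisymm (key w) ?_
    simpa only [map_neg, neg_le_neg_iff] using key (-w)
  exact ⟨L₁ + J α α', fun w => ⟨lower w, heq ▸ upper w⟩⟩

/-- The sandwich of `exists_quadratic_sandwich`, with the first component of the linear form
identified as the partial gradient. -/
theorem exists_quadratic_sandwich_gradient {v : E × F → ℝ} {α α' β β' : ℝ}
    (hconv : ConvexOn ℝ univ fun p : E × F => v p - α * ‖p.1‖ ^ 2 - α' * ‖p.2‖ ^ 2)
    (hconc : ConcaveOn ℝ univ fun p : E × F => v p - β * ‖p.1‖ ^ 2 - β' * ‖p.2‖ ^ 2)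
    (x : E) (y : F) :
    ∃ r : StrongDual ℝ F, ∀ h k,
      v (x, y) + inner ℝ (gradient (fun a => v (a, y)) x) h + r k
        + α * ‖h‖ ^ 2 + α' * ‖k‖ ^ 2 ≤ v (x + h, y + k) ∧
      v (x + h, y + k) ≤ v (x, y) + inner ℝ (gradient (fun a => v (a, y)) x) h + r k
        + β * ‖h‖ ^ 2 + β' * ‖k‖ ^ 2 := by
  obtain ⟨L, hL⟩ := exists_quadratic_sandwich hconv hconc (x, y)
  let p : E := (InnerProductSpace.toDual ℝ E).symm (L.comp (ContinuousLinearMap.inl ℝ E F))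
  have hp : ∀ h, inner ℝ p h = L (h, 0) := fun h => by
    simp [p]
  have hgrad : HasGradientAt (fun a => v (a, y)) p x := by
    rw [hasGradientAt_iff_isLittleO_nhds_zero]
    have hO : (fun h : E => v (x + h, y) - v (x, y) - inner ℝ p h) =O[nhds 0]
        fun h => ‖h‖ ^ 2 := by
      refine Asymptotics.IsBigO.of_bound (max |α| |β|) (Filter.Eventually.of_forall fun h => ?_)
      have := hL (h, 0)
      simp only [Prod.mk_add_mk, add_zero, norm_zero, ne_eq, OfNat.ofNat_ne_zero,
        not_false_eq_true, zero_pow, mul_zero, ← hp] at this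
      rw [Real.norm_eq_abs, Real.norm_of_nonneg (by positivity), abs_le]
      have h2 : 0 ≤ ‖h‖ ^ 2 := by positivity
      have h3 : -(max |α| |β|) ≤ α := (neg_le_neg (le_max_left _ _)).trans (neg_abs_le α)
      have h4 : β ≤ max |α| |β| := (le_abs_self β).trans (le_max_right _ _)
      constructor
      · nlinarith
      · nlinarith
    refine hO.trans_isLittleO ?_
    simpa using Asymptotics.isLittleO_norm_pow_id (E' := E) one_lt_two
  rw [hgrad.gradient]
  refine ⟨L.comp (ContinuousLinearMap.inr ℝ E F), fun h k => ?_⟩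
  have hhk : L (h, k) = inner ℝ p h + L (0, k) := by
    rw [hp, ← map_add]; simp
  have := hL (h, k)
  simp only [hhk, Prod.mk_add_mk] at this
  simpa [add_assoc] using this

/-- Block Hessian bounds control the radial part of the difference of two partial gradients. -/
theorem inner_gradient_sub_bounds {v : E × F → ℝ} {α α' β β' : ℝ}
    (hconv : ConvexOn ℝ univ fun p : E × F => v p - α * ‖p.1‖ ^ 2 - α' * ‖p.2‖ ^ 2)
    (hconc : ConcaveOn ℝ univ fun p : E × F => v p - β * ‖p.1‖ ^ 2 - β' * ‖p.2‖ ^ 2)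
    (x x' : E) (y y' : F) :
    2 * α * ‖x - x'‖ ^ 2 - 2 * √((β - α) * (β' - α')) * ‖y - y'‖ * ‖x - x'‖ ≤
        inner ℝ (x - x')
          (gradient (fun a => v (a, y)) x - gradient (fun a => v (a, y')) x') ∧
      inner ℝ (x - x')
          (gradient (fun a => v (a, y)) x - gradient (fun a => v (a, y')) x') ≤
        2 * β * ‖x - x'‖ ^ 2 + 2 * √((β - α) * (β' - α')) * ‖y - y'‖ * ‖x - x'‖ := by
  obtain ⟨r, hr⟩ := exists_quadratic_sandwich_gradient hconv hconc x y
  obtain ⟨r₁, hr₁⟩ := exists_quadratic_sandwich_gradient hconv hconc x' y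
  obtain ⟨r₂, hr₂⟩ := exists_quadratic_sandwich_gradient hconv hconc x' y'
  set p := gradient (fun a => v (a, y)) x
  set p₁ := gradient (fun a => v (a, y)) x'
  set p₂ := gradient (fun a => v (a, y')) x'
  have hcross : ‖p₁ - p₂‖ ≤ 2 * √((β - α) * (β' - α')) * ‖y - y'‖ := by
    set q := p₁ - p₂ with hq
    have hquad : ∀ l : ℝ, 0 ≤ (β - α) * ‖q‖ ^ 2 * (l * l) + (-‖q‖ ^ 2) * l +
        (β' - α') * ‖y - y'‖ ^ 2 := by
      intro l
      have h₁ := (hr₁ (l • q) (y' - y)).1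
      have h₂ := (hr₁ 0 (y' - y)).2
      have h₃ := (hr₂ (l • q) 0).2
      have h₄ : inner ℝ p₁ (l • q) - inner ℝ p₂ (l • q) = l * ‖q‖ ^ 2 := by
        rw [← inner_sub_left, ← hq, inner_smul_right, real_inner_self_eq_norm_sq]
      simp only [norm_smul, mul_pow, Real.norm_eq_abs, sq_abs, add_sub_cancel, add_zero,
        inner_zero_right, norm_zero, map_zero, norm_sub_rev y' y] at h₁ h₂ h₃
      nlinarith
    have hdisc := discrim_le_zero hquad
    rw [discrim] at hdisc
    rcases (norm_nonneg q).eq_or_lt with h0 | h0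
    · rw [← h0]; positivity
    have hsq : ‖q‖ ^ 2 ≤ (β - α) * (β' - α') * (2 * ‖y - y'‖) ^ 2 := by
      have : 0 < ‖q‖ ^ 2 := by positivity
      nlinarith
    calc ‖q‖ ≤ √((β - α) * (β' - α') * (2 * ‖y - y'‖) ^ 2) := Real.le_sqrt_of_sq_le hsq
      _ = _ := by rw [Real.sqrt_mul' _ (sq_nonneg _), Real.sqrt_sq (by positivity)]; ring
  have hcs := abs_le.1 (abs_real_inner_le_norm (x - x') (p₁ - p₂))
  have hcs' : ‖x - x'‖ * ‖p₁ - p₂‖ ≤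
      2 * √((β - α) * (β' - α')) * ‖y - y'‖ * ‖x - x'‖ := by
    rw [mul_comm]; gcongr
  have hsplit : inner ℝ (x - x') (p - p₂) =
      inner ℝ (x - x') (p - p₁) + inner ℝ (x - x') (p₁ - p₂) := by
    rw [← inner_add_right, sub_add_sub_cancel]
  have h₁ := hr (x' - x) 0
  have h₂ := hr₁ (x - x') 0
  have h₃ : inner ℝ p (x' - x) = - inner ℝ (x - x') p := by
    rw [← neg_sub, inner_neg_right, real_inner_comm]
  have h₄ : inner ℝ p₁ (x - x') = inner ℝ (x - x') p₁ := real_inner_comm _ _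
  simp only [add_sub_cancel, add_zero, norm_zero, map_zero, norm_sub_rev x' x, h₃, h₄] at h₁ h₂
  rw [hsplit, inner_sub_right (x - x') p p₁]
  constructor <;> linarith

end Gradient

/-- Comparison principle: a one-sided bound on the radial speed of `w` by the speed of a monotone
function `φ` bounds the growth (`σ = 1`) or decay (`σ = -1`) of `‖w‖`. -/
theorem antitoneOn_mul_norm_sub {E : Type*} [NormedAddCommGroup E] [InnerProductSpace ℝ E]
    {w w' : ℝ → E} {φ φ' : ℝ → ℝ} {σ : ℝ}
    (hw : ∀ u ∈ Ici (0 : ℝ), HasDerivWithinAt w (w' u) (Ici 0) u)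
    (hφ : ∀ u ∈ Ici (0 : ℝ), HasDerivWithinAt φ (φ' u) (Ici 0) u)
    (hφ' : ∀ u ∈ Ici (0 : ℝ), 0 ≤ φ' u)
    (hbound : ∀ u ∈ Ici (0 : ℝ), σ * inner ℝ (w u) (w' u) ≤ ‖w u‖ * φ' u) :
    AntitoneOn (fun u => σ * ‖w u‖ - φ u) (Ici 0) := by
  have regularized : ∀ ε > 0, AntitoneOn (fun u => σ * √(‖w u‖ ^ 2 + ε ^ 2) - φ u) (Ici 0) := by
    intro ε hε
    have hder : ∀ u ∈ Ici (0 : ℝ), HasDerivWithinAt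
        (fun u => σ * √(‖w u‖ ^ 2 + ε ^ 2) - φ u)
        (σ * (2 * inner ℝ (w u) (w' u) / (2 * √(‖w u‖ ^ 2 + ε ^ 2))) - φ' u) (Ici 0) u := by
      intro u hu
      have hpos : ‖w u‖ ^ 2 + ε ^ 2 ≠ 0 := by positivity
      exact ((((hw u hu).norm_sq.add_const _).sqrt hpos).const_mul σ).sub (hφ u hu)
    refine antitoneOn_of_deriv_nonpos (convex_Ici 0)
      (fun u hu => (hder u hu).continuousWithinAt)
      (fun u hu => ((hder u (interior_subset hu)).mono interior_subset).differentiableWithinAt)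
      fun u hu => ?_
    have hu0 : u ∈ Ici (0 : ℝ) := interior_subset hu
    rw [((hder u hu0).hasDerivAt (mem_interior_iff_mem_nhds.1 hu)).deriv]
    have hS : 0 < √(‖w u‖ ^ 2 + ε ^ 2) := Real.sqrt_pos.2 (by positivity)
    have hwS : ‖w u‖ ≤ √(‖w u‖ ^ 2 + ε ^ 2) := Real.le_sqrt_of_sq_le (by nlinarith)
    rw [mul_div_mul_left _ _ two_ne_zero, ← mul_div_assoc, sub_nonpos, div_le_iff₀ hS,
      mul_comm (φ' u)]
    exact (hbound u hu0).trans (mul_le_mul_of_nonneg_right hwS (hφ' u hu0))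
  intro a ha b hb hab
  have hlim : ∀ u, Filter.Tendsto (fun ε : ℝ => σ * √(‖w u‖ ^ 2 + ε ^ 2) - φ u)
      (nhdsWithin 0 (Ioi 0)) (nhds (σ * ‖w u‖ - φ u)) := by
    intro u
    have hc : Continuous fun ε : ℝ => σ * √(‖w u‖ ^ 2 + ε ^ 2) - φ u := by fun_prop
    simpa using (hc.tendsto 0).mono_left nhdsWithin_le_nhds
  refine le_of_tendsto_of_tendsto (hlim b) (hlim a) ?_
  filter_upwards [self_mem_nhdsWithin] with ε hε
  exact regularized ε hε ha hb hab

theorem one_add_mul_pos {k u : ℝ} (hk : 0 < k) (hu : 0 ≤ u) : 0 < 1 + k * u := by positivity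

theorem hasDerivAt_inv_sqrt_one_add_mul {k u : ℝ} (h : 0 < 1 + k * u) :
    HasDerivAt (fun u => (√(1 + k * u))⁻¹) (-(k / (2 * √(1 + k * u) * (1 + k * u)))) u := by
  have hlin : HasDerivAt (fun u => 1 + k * u) k u := by
    simpa using ((hasDerivAt_id u).const_mul k).const_add 1
  refine ((hlin.sqrt h.ne').fun_inv (Real.sqrt_pos.2 h).ne').congr_deriv ?_
  rw [Real.sq_sqrt h.le, neg_div, div_div]

/-- Growth of solutions of a linear differential inequality with rate `k / (1 + k u)` and a source
term dominated by `(1 + u) ^ (-3/2)`. -/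
theorem antitoneOn_rescaled_norm {E : Type*} [NormedAddCommGroup E] [InnerProductSpace ℝ E]
    {δ g : ℝ → E} {B : ℝ → ℝ} {k K σ : ℝ} (hk : 0 < k) (hK : 0 ≤ K)
    (hδ : ∀ u ∈ Ici (0 : ℝ), HasDerivWithinAt δ ((1 / 2 : ℝ) • g u) (Ici 0) u)
    (hg : ∀ u ∈ Ici (0 : ℝ), σ * inner ℝ (δ u) (g u) ≤
      σ * (k / (1 + k * u)) * ‖δ u‖ ^ 2 + B u * ‖δ u‖)
    (hB : ∀ u ∈ Ici (0 : ℝ), B u / √(1 + k * u) ≤ K / (√(1 + u) * (1 + u))) :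
    AntitoneOn (fun u => σ * ((√(1 + k * u))⁻¹ * ‖δ u‖) + K * (√(1 + u))⁻¹) (Ici 0) := by
  have hmain := antitoneOn_mul_norm_sub (σ := σ)
    (w := fun u => (√(1 + k * u))⁻¹ • δ u)
    (φ := fun u => -(K * (√(1 + 1 * u))⁻¹))
    (fun u hu => (hasDerivAt_inv_sqrt_one_add_mul
      (one_add_mul_pos hk hu)).hasDerivWithinAt.fun_smul (hδ u hu))
    (fun u hu => (((hasDerivAt_inv_sqrt_one_add_mul
      (one_add_mul_pos one_pos hu)).const_mul K).fun_neg).hasDerivWithinAt)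
    (fun u hu => by
      have := one_add_mul_pos one_pos (mem_Ici.1 hu)
      rw [mul_neg, neg_neg]
      positivity)
    (fun u hu => by
      have hpos := one_add_mul_pos hk (mem_Ici.1 hu)
      have hpos1 : 0 < 1 + u := by simpa using one_add_mul_pos one_pos (mem_Ici.1 hu)
      have hg := hg u hu
      have hB := hB u hu
      have hS : 0 < √(1 + k * u) := Real.sqrt_pos.2 hpos
      have hR : 0 < √(1 + u) := Real.sqrt_pos.2 hpos1
      have hSS : √(1 + k * u) ^ 2 = 1 + k * u := Real.sq_sqrt hpos.le
      simp only [one_mul, norm_smul, norm_inv, Real.norm_of_nonneg hS.le, inner_add_right,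
        real_inner_smul_left, real_inner_smul_right, real_inner_self_eq_norm_sq]
      rw [← hSS] at hg ⊢
      rw [Real.sqrt_sq hS.le]
      set S := √(1 + k * u)
      set R := √(1 + u)
      calc _ = S⁻¹ ^ 2 * (1 / 2) *
            (σ * inner ℝ (δ u) (g u) - σ * (k / S ^ 2) * ‖δ u‖ ^ 2) := by
              field_simp
              ring
        _ ≤ S⁻¹ ^ 2 * (1 / 2) * (B u * ‖δ u‖) := by gcongr; linarith
        _ = S⁻¹ * ‖δ u‖ * (1 / 2) * (B u / S) := by field_simp
        _ ≤ S⁻¹ * ‖δ u‖ * (1 / 2) * (K / (R * (1 + u))) := by gcongr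
        _ = _ := by field_simp)
  refine hmain.congr fun u hu => ?_
  simp [norm_smul, abs_of_nonneg (Real.sqrt_nonneg _)]

theorem min_one_mul_one_add_le {k u : ℝ} (hu : 0 ≤ u) : min 1 k * (1 + u) ≤ 1 + k * u := by
  nlinarith [min_le_left 1 k, mul_le_mul_of_nonneg_right (min_le_right 1 k) hu]

theorem one_add_mul_le_max_one_mul {k u : ℝ} (hu : 0 ≤ u) : 1 + k * u ≤ max 1 k * (1 + u) := by
  nlinarith [le_max_left 1 k, mul_le_mul_of_nonneg_right (le_max_right 1 k) hu]

theorem source_term_le {c C k u N : ℝ} (hc : 0 < c) (hcC : c ≤ C) (hk : 0 < k) (hN : 0 ≤ N)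
    (hu : 0 ≤ u) :
    (C - c) / √((1 + C * u) * (1 + c * u)) * N / √(1 + k * u) ≤
      (C - c) / √(min 1 k * min 1 C * min 1 c) * N / (√(1 + u) * (1 + u)) := by
  have hC : 0 < C := hc.trans_le hcC
  have hm : ∀ a : ℝ, 0 < a → 0 < min 1 a := fun a ha => lt_min one_pos ha
  have hmk := hm k hk
  have hmC := hm C hC
  have hmc := hm c hc
  have hp1 : 0 < 1 + u := by positivity
  have hpk := one_add_mul_pos hk hu
  have hpC := one_add_mul_pos hC hu
  have hpc := one_add_mul_pos hc hu
  have hR : √(1 + u) * (1 + u) = √((1 + u) ^ 3) := by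
    rw [pow_succ', Real.sqrt_mul hp1.le, Real.sqrt_sq hp1.le]
  have hden : √(min 1 k * min 1 C * min 1 c) * (√(1 + u) * (1 + u)) ≤
      √((1 + C * u) * (1 + c * u)) * √(1 + k * u) := by
    rw [hR, ← Real.sqrt_mul (by positivity), ← Real.sqrt_mul (by positivity)]
    apply Real.sqrt_le_sqrt
    calc _ = (min 1 C * (1 + u)) * (min 1 c * (1 + u)) * (min 1 k * (1 + u)) := by ring
      _ ≤ _ := by
        have h₁ := min_one_mul_one_add_le (k := C) hu
        have h₂ := min_one_mul_one_add_le (k := c) hu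
        have h₃ := min_one_mul_one_add_le (k := k) hu
        gcongr
  have hD : 0 ≤ (C - c) * N := mul_nonneg (sub_nonneg.2 hcC) hN
  rw [div_mul_eq_mul_div, div_mul_eq_mul_div, div_div, div_div]
  exact div_le_div_of_nonneg_left hD (by positivity) hden

section Flow

variable {E F : Type*}
  [NormedAddCommGroup E] [InnerProductSpace ℝ E] [FiniteDimensional ℝ E]
  [NormedAddCommGroup F] [InnerProductSpace ℝ F] [FiniteDimensional ℝ F]

/-- Two trajectories of the flow, with rescaled distances compared at times `s` and `t`. -/
theorem rescaled_norm_sub_le {c C : ℝ} (hc : 0 < c) (hcC : c ≤ C) {V : ℝ → E × F → ℝ}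
    (hconv : ∀ s ∈ Ici (0 : ℝ), ConvexOn ℝ univ
      (fun p : E × F =>
        V s p - c / (2 * (1 + c * s)) * ‖p.1‖ ^ 2 - c / 2 * ‖p.2‖ ^ 2))
    (hconc : ∀ s ∈ Ici (0 : ℝ), ConcaveOn ℝ univ
      (fun p : E × F =>
        V s p - C / (2 * (1 + C * s)) * ‖p.1‖ ^ 2 - C / 2 * ‖p.2‖ ^ 2))
    {X X' : ℝ → E} {y y' : F}
    (hX : ∀ u ∈ Ici (0 : ℝ), HasDerivWithinAt X
      ((1 / 2 : ℝ) • gradient (fun a => V u (a, y)) (X u)) (Ici 0) u)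
    (hX' : ∀ u ∈ Ici (0 : ℝ), HasDerivWithinAt X'
      ((1 / 2 : ℝ) • gradient (fun a => V u (a, y')) (X' u)) (Ici 0) u)
    {s t : ℝ} (hs : 0 ≤ s) (ht : 0 ≤ t) :
    ∃ k, (k = c ∨ k = C) ∧ (√(1 + k * s))⁻¹ * ‖X s - X' s‖ ≤
      (√(1 + k * t))⁻¹ * ‖X t - X' t‖ +
        (C - c) / √(min 1 k * min 1 C * min 1 c) * ‖y - y'‖ *
          |(√(1 + s))⁻¹ - (√(1 + t))⁻¹| := by
  have hC : 0 < C := hc.trans_le hcC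
  have hδ : ∀ u ∈ Ici (0 : ℝ), HasDerivWithinAt (fun u => X u - X' u)
      ((1 / 2 : ℝ) • (gradient (fun a => V u (a, y)) (X u) -
        gradient (fun a => V u (a, y')) (X' u))) (Ici 0) u := fun u hu => by
    rw [smul_sub]
    exact (hX u hu).fun_sub (hX' u hu)
  have hbounds : ∀ u ∈ Ici (0 : ℝ), _ := fun u hu =>
    inner_gradient_sub_bounds (hconv u hu) (hconc u hu) (X u) (X' u) y y'
  have hcoef : ∀ k u : ℝ, 2 * (k / (2 * (1 + k * u))) = k / (1 + k * u) := fun k u => by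
    rw [← mul_div_assoc, mul_div_mul_left _ _ two_ne_zero]
  have hcross : ∀ u ∈ Ici (0 : ℝ),
      2 * √((C / (2 * (1 + C * u)) - c / (2 * (1 + c * u))) * (C / 2 - c / 2)) =
        (C - c) / √((1 + C * u) * (1 + c * u)) := by
    intro u hu
    have hpC := one_add_mul_pos hC (mem_Ici.1 hu)
    have hpc := one_add_mul_pos hc (mem_Ici.1 hu)
    have : (C / (2 * (1 + C * u)) - c / (2 * (1 + c * u))) * (C / 2 - c / 2) =
        ((C - c) / 2) ^ 2 / ((1 + C * u) * (1 + c * u)) := by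
      rw [div_sub_div _ _ (by positivity) (by positivity), div_mul_eq_mul_div,
        div_eq_div_iff (by positivity) (by positivity)]
      ring
    rw [this, Real.sqrt_div (sq_nonneg _), Real.sqrt_sq (by linarith)]
    ring
  have hDN : 0 ≤ (C - c) * ‖y - y'‖ := mul_nonneg (sub_nonneg.2 hcC) (norm_nonneg _)
  have hK : ∀ k, 0 ≤ (C - c) / √(min 1 k * min 1 C * min 1 c) * ‖y - y'‖ := fun k => by
    rw [div_mul_eq_mul_div]
    exact div_nonneg hDN (Real.sqrt_nonneg _)
  rcases le_total t s with hts | hst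
  · refine ⟨C, Or.inr rfl, ?_⟩
    have hanti := antitoneOn_rescaled_norm (σ := 1) hC (hK C) hδ
      (B := fun u => (C - c) / √((1 + C * u) * (1 + c * u)) * ‖y - y'‖)
      (fun u hu => by
        have := (hbounds u hu).2
        rw [hcoef, hcross u hu] at this
        simpa using this)
      (fun u hu => source_term_le hc hcC hC (norm_nonneg _) hu)
      (mem_Ici.2 ht) (mem_Ici.2 hs) hts
    have := mul_le_mul_of_nonneg_left (neg_abs_le ((√(1 + s))⁻¹ - (√(1 + t))⁻¹)) (hK C)
    simp only [one_mul] at hanti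
    linarith
  · refine ⟨c, Or.inl rfl, ?_⟩
    have hanti := antitoneOn_rescaled_norm (σ := -1) hc (hK c) hδ
      (B := fun u => (C - c) / √((1 + C * u) * (1 + c * u)) * ‖y - y'‖)
      (fun u hu => by
        have := (hbounds u hu).1
        rw [hcoef, hcross u hu] at this
        linarith)
      (fun u hu => source_term_le hc hcC hc (norm_nonneg _) hu)
      (mem_Ici.2 hs) (mem_Ici.2 ht) hst
    have := mul_le_mul_of_nonneg_left (le_abs_self ((√(1 + s))⁻¹ - (√(1 + t))⁻¹)) (hK c)
    simp only [neg_mul, one_mul] at hanti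
    linarith

end Flow

theorem max_one_div_min_one_le {c C k : ℝ} (hc : 0 < c) (hcC : c ≤ C) (hk : k = c ∨ k = C) :
    max 1 k / min 1 k ≤ max C (1 / c) := by
  have hck : c ≤ k := by rcases hk with rfl | rfl <;> simp [hcC]
  have hkC : k ≤ C := by rcases hk with rfl | rfl <;> simp [hcC]
  rcases le_total k 1 with h | h
  · rw [max_eq_left h, min_eq_right h]
    exact (one_div_le_one_div_of_le hc hck).trans (le_max_right _ _)
  · rw [max_eq_right h, min_eq_left h, div_one]
    exact hkC.trans (le_max_left _ _)

theorem sq_mul_max_one_le {c C k : ℝ} (hc : 0 < c) (hcC : c ≤ C) (hk : k = c ∨ k = C) :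
    c ^ 2 * max 1 k ≤ max C (1 / C) ^ 3 * (min 1 k * min 1 C * min 1 c) := by
  have hC : 0 < C := hc.trans_le hcC
  rcases le_total C 1 with hC1 | hC1
  · have hc1 : c ≤ 1 := hcC.trans hC1
    have hk1 : k ≤ 1 := by rcases hk with rfl | rfl <;> assumption
    have hCk : c ≤ k := by rcases hk with rfl | rfl <;> simp [hcC]
    have hle : C ≤ 1 / C := hC1.trans ((le_div_iff₀ hC).2 (by linarith))
    rw [max_eq_left hk1, max_eq_right hle, min_eq_right hk1, min_eq_right hC1, min_eq_right hc1,
      div_pow, one_pow, div_mul_eq_mul_div, le_div_iff₀ (by positivity)]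
    calc c ^ 2 * 1 * C ^ 3 = (c * c) * C * C ^ 2 := by ring
      _ ≤ (k * c) * C * 1 := by
        have : C ^ 2 ≤ 1 := pow_le_one₀ hC.le hC1
        have : 0 ≤ k := hc.le.trans hCk
        gcongr
      _ = _ := by ring
  · have hle : 1 / C ≤ C := ((div_le_one hC).2 hC1).trans hC1
    rw [max_eq_left hle, min_eq_left hC1, mul_one]
    have hC3 : C ≤ C ^ 3 := le_self_pow₀ hC1 (by norm_num)
    have h13 : 1 ≤ C ^ 3 := hC1.trans hC3
    rcases hk with rfl | rfl
    · rcases le_total k 1 with h | h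
      · rw [max_eq_left h, min_eq_right h]
        nlinarith [sq_nonneg k]
      · rw [max_eq_right h, min_eq_left h]
        have : k ^ 3 ≤ C ^ 3 := by gcongr
        nlinarith
    · rw [max_eq_right hC1, min_eq_left hC1]
      rcases le_total c 1 with h | h
      · rw [min_eq_right h]
        have : c ^ 2 ≤ c := by nlinarith
        nlinarith
      · rw [min_eq_left h]
        have : c ^ 2 ≤ k ^ 2 := by gcongr
        nlinarith

theorem rpow_nat_div_two {M : ℝ} (hM : 0 ≤ M) (n : ℕ) : M ^ ((n : ℝ) / 2) = √(M ^ n) := by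
  rw [Real.sqrt_eq_rpow, ← Real.rpow_natCast, ← Real.rpow_mul hM, mul_one_div]

theorem sqrt_max_one_mul_div_le {c C k : ℝ} (hc : 0 < c) (hcC : c ≤ C) (hk : k = c ∨ k = C) :
    √(max 1 k) * ((C - c) / √(min 1 k * min 1 C * min 1 c)) ≤
      (C / c - 1) * max C (1 / C) ^ ((3 : ℝ) / 2) := by
  have hC : 0 < C := hc.trans_le hcC
  have hkpos : 0 < k := by rcases hk with rfl | rfl <;> assumption
  have hm : ∀ a : ℝ, 0 < a → 0 < min 1 a := fun a ha => lt_min one_pos ha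
  have hmk := hm k hkpos
  have hmC := hm C hC
  have hmc := hm c hc
  have hM : 0 < max C (1 / C) := lt_max_of_lt_left hC
  have hpow := rpow_nat_div_two hM.le 3
  push_cast at hpow
  have hroot : c * √(max 1 k) ≤
      √(max C (1 / C) ^ 3) * √(min 1 k * min 1 C * min 1 c) := by
    rw [← Real.sqrt_mul (by positivity)]
    refine Real.le_sqrt_of_sq_le ?_
    rw [mul_pow, Real.sq_sqrt (by positivity)]
    exact sq_mul_max_one_le hc hcC hk
  have hP : 0 < √(min 1 k * min 1 C * min 1 c) := Real.sqrt_pos.2 (by positivity)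
  have hsub : C / c - 1 = (C - c) / c := by field_simp
  rw [hpow, hsub, ← mul_div_assoc, div_le_iff₀ hP, div_mul_eq_mul_div, div_mul_eq_mul_div,
    le_div_iff₀ hc]
  calc _ = (C - c) * (c * √(max 1 k)) := by ring
    _ ≤ (C - c) * (√(max C (1 / C) ^ 3) * √(min 1 k * min 1 C * min 1 c)) :=
      mul_le_mul_of_nonneg_left hroot (sub_nonneg.2 hcC)
    _ = _ := by ring

/-- The combined constant: `√M` and `(M² - 1) M ^ (3/2)` have Euclidean sum at most `M ^ (7/2)`. -/
theorem add_le_rpow_mul_sqrt {M A B : ℝ} (hM : 1 ≤ M) :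
    √M * A + (M ^ 2 - 1) * M ^ ((3 : ℝ) / 2) * B ≤ M ^ ((7 : ℝ) / 2) * √(A ^ 2 + B ^ 2) := by
  have hM0 : 0 ≤ M := zero_le_one.trans hM
  have h3 := rpow_nat_div_two hM0 3
  have h7 := rpow_nat_div_two hM0 7
  push_cast at h3 h7
  have hr3 : √(M ^ 3) = M * √M := by
    rw [pow_succ, Real.sqrt_mul (by positivity), Real.sqrt_sq hM0]
  have hr7 : √(M ^ 7) = M ^ 3 * √M := by
    rw [show M ^ 7 = (M ^ 3) ^ 2 * M by ring, Real.sqrt_mul (by positivity),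
      Real.sqrt_sq (by positivity)]
  have hcauchy : A + (M ^ 2 - 1) * M * B ≤ M ^ 3 * √(A ^ 2 + B ^ 2) := by
    rw [← Real.sqrt_sq (show 0 ≤ M ^ 3 by positivity), ← Real.sqrt_mul (by positivity)]
    refine Real.le_sqrt_of_sq_le ?_
    have hconst : 1 + ((M ^ 2 - 1) * M) ^ 2 ≤ (M ^ 3) ^ 2 := by
      nlinarith [one_le_pow₀ hM (n := 2), one_le_pow₀ hM (n := 4)]
    calc _ ≤ (1 + ((M ^ 2 - 1) * M) ^ 2) * (A ^ 2 + B ^ 2) := by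
          nlinarith [sq_nonneg (B - (M ^ 2 - 1) * M * A)]
      _ ≤ _ := by gcongr
  rw [h3, h7, hr3, hr7]
  calc _ = √M * (A + (M ^ 2 - 1) * M * B) := by ring
    _ ≤ √M * (M ^ 3 * √(A ^ 2 + B ^ 2)) := by gcongr
    _ = _ := by ring

/-- uniform Lipschitz estimates for the renormalized transport maps
`F̃_{s,t}(x,y) = e^{-s/2} F_{e^s−1, e^t−1}(e^{t/2} x, y)`. -/
theorem stmt16 {E F : Type*}
    [NormedAddCommGroup E] [InnerProductSpace ℝ E] [FiniteDimensional ℝ E]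
    [NormedAddCommGroup F] [InnerProductSpace ℝ F] [FiniteDimensional ℝ F]
    (c C : ℝ) (hc : 0 < c) (hcC : c ≤ C)
    (V : ℝ → E × F → ℝ)
    (hconv : ∀ s ∈ Ici (0 : ℝ), ConvexOn ℝ univ
      (fun p : E × F =>
        V s p - c / (2 * (1 + c * s)) * ‖p.1‖ ^ 2 - c / 2 * ‖p.2‖ ^ 2))
    (hconc : ∀ s ∈ Ici (0 : ℝ), ConcaveOn ℝ univ
      (fun p : E × F =>
        V s p - C / (2 * (1 + C * s)) * ‖p.1‖ ^ 2 - C / 2 * ‖p.2‖ ^ 2))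
    (Fmap : ℝ → ℝ → E → F → E)
    (hF0 : ∀ t ∈ Ici (0 : ℝ), ∀ (x : E) (y : F), Fmap t t x y = x)
    (hFode : ∀ t ∈ Ici (0 : ℝ), ∀ (x : E) (y : F), ∀ s ∈ Ici (0 : ℝ),
      HasDerivWithinAt (fun s' => Fmap s' t x y)
        ((1 / 2 : ℝ) • gradient (fun a => V s (a, y)) (Fmap s t x y)) (Ici 0) s)
    (Ft : ℝ → ℝ → E → F → E)
    (hFt : ∀ (s t : ℝ) (x : E) (y : F),
      Ft s t x y =
        Real.exp (-s / 2) •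
          Fmap (Real.exp s - 1) (Real.exp t - 1) (Real.exp (t / 2) • x) y) :
    ∀ s ∈ Ici (0 : ℝ), ∀ t ∈ Ici (0 : ℝ),
      (∀ (y : F) (x x' : E),
        ‖Ft s t x y - Ft s t x' y‖ ≤ Real.sqrt (max C (1 / c)) * ‖x - x'‖) ∧
      (∀ (x : E) (y y' : F),
        ‖Ft s t x y - Ft s t x y'‖ ≤
          (C / c - 1) * (max C (1 / C)) ^ ((3 : ℝ) / 2) *
            |Real.exp (-s / 2) - Real.exp (-t / 2)| * ‖y - y'‖) ∧
      (∀ (x x' : E) (y y' : F),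
        ‖Ft s t x y - Ft s t x' y'‖ ≤
          (max C (1 / c)) ^ ((7 : ℝ) / 2) *
            Real.sqrt (‖x - x'‖ ^ 2 + ‖y - y'‖ ^ 2)) := by
  have hC : 0 < C := hc.trans_le hcC
  intro s hs t ht
  have hshift : ∀ {r : ℝ}, r ∈ Ici (0 : ℝ) → Real.exp r - 1 ∈ Ici (0 : ℝ) := fun hr =>
    sub_nonneg.2 (Real.one_le_exp hr)
  have hmain : ∀ (x x' : E) (y y' : F), ∃ k, (k = c ∨ k = C) ∧
      ‖Ft s t x y - Ft s t x' y'‖ ≤ √(max 1 k) * ((√(min 1 k))⁻¹ * ‖x - x'‖ +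
        (C - c) / √(min 1 k * min 1 C * min 1 c) * ‖y - y'‖ *
          |Real.exp (-s / 2) - Real.exp (-t / 2)|) := by
    intro x x' y y'
    obtain ⟨k, hk, hle⟩ := rescaled_norm_sub_le hc hcC hconv hconc
      (hFode _ (hshift ht) (Real.exp (t / 2) • x) y)
      (hFode _ (hshift ht) (Real.exp (t / 2) • x') y') (hshift hs) (hshift ht)
    have hkpos : 0 < k := by rcases hk with rfl | rfl <;> assumption
    refine ⟨k, hk, ?_⟩
    have hsqrt : ∀ r : ℝ, √(Real.exp r) = Real.exp (r / 2) := fun r => (Real.exp_half r).symm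
    have hinv : ∀ r : ℝ, (√(1 + (Real.exp r - 1)))⁻¹ = Real.exp (-r / 2) := fun r => by
      rw [add_sub_cancel, hsqrt, ← Real.exp_neg, neg_div]
    rw [hF0 _ (hshift ht), hF0 _ (hshift ht), ← smul_sub, norm_smul,
      Real.norm_of_nonneg (Real.exp_pos _).le, hinv, hinv] at hle
    rw [hFt, hFt, ← smul_sub, norm_smul, Real.norm_of_nonneg (Real.exp_pos _).le]
    set d := ‖Fmap (Real.exp s - 1) (Real.exp t - 1) (Real.exp (t / 2) • x) y -
      Fmap (Real.exp s - 1) (Real.exp t - 1) (Real.exp (t / 2) • x') y'‖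
    have hS : 0 < √(1 + k * (Real.exp s - 1)) :=
      Real.sqrt_pos.2 (one_add_mul_pos hkpos (hshift hs))
    have hT : 0 < √(1 + k * (Real.exp t - 1)) :=
      Real.sqrt_pos.2 (one_add_mul_pos hkpos (hshift ht))
    have hmin : 0 < min 1 k := lt_min one_pos hkpos
    have hupper : Real.exp (-s / 2) * √(1 + k * (Real.exp s - 1)) ≤ √(max 1 k) := by
      have := Real.sqrt_le_sqrt (one_add_mul_le_max_one_mul (k := k) (hshift hs))
      rw [add_sub_cancel, Real.sqrt_mul (by positivity), hsqrt] at this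
      rwa [neg_div, Real.exp_neg, inv_mul_eq_div, div_le_iff₀ (Real.exp_pos _)]
    have hlower : (√(1 + k * (Real.exp t - 1)))⁻¹ * Real.exp (t / 2) ≤ (√(min 1 k))⁻¹ := by
      have := Real.sqrt_le_sqrt (min_one_mul_one_add_le (k := k) (hshift ht))
      rw [add_sub_cancel, Real.sqrt_mul hmin.le, hsqrt] at this
      rwa [inv_mul_eq_div, div_le_iff₀ hT, inv_mul_eq_div, le_div_iff₀ (Real.sqrt_pos.2 hmin),
        mul_comm]
    calc Real.exp (-s / 2) * d = Real.exp (-s / 2) * √(1 + k * (Real.exp s - 1)) *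
          ((√(1 + k * (Real.exp s - 1)))⁻¹ * d) := by field_simp
      _ ≤ √(max 1 k) * ((√(1 + k * (Real.exp s - 1)))⁻¹ * d) := by gcongr
      _ ≤ √(max 1 k) * (((√(1 + k * (Real.exp t - 1)))⁻¹ * Real.exp (t / 2)) * ‖x - x'‖ +
          (C - c) / √(min 1 k * min 1 C * min 1 c) * ‖y - y'‖ *
            |Real.exp (-s / 2) - Real.exp (-t / 2)|) := by
        rw [mul_assoc (√(1 + k * (Real.exp t - 1)))⁻¹]
        gcongr
      _ ≤ _ := by gcongr
  have hx : ∀ (y : F) (x x' : E),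
      ‖Ft s t x y - Ft s t x' y‖ ≤ Real.sqrt (max C (1 / c)) * ‖x - x'‖ := by
    intro y x x'
    obtain ⟨k, hk, hle⟩ := hmain x x' y y
    refine hle.trans ?_
    rw [sub_self, norm_zero, mul_zero, zero_mul, add_zero, ← mul_assoc, ← div_eq_mul_inv,
      ← Real.sqrt_div (by positivity)]
    gcongr
    exact max_one_div_min_one_le hc hcC hk
  have hy : ∀ (x : E) (y y' : F),
      ‖Ft s t x y - Ft s t x y'‖ ≤
        (C / c - 1) * (max C (1 / C)) ^ ((3 : ℝ) / 2) *
          |Real.exp (-s / 2) - Real.exp (-t / 2)| * ‖y - y'‖ := by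
    intro x y y'
    obtain ⟨k, hk, hle⟩ := hmain x x y y'
    refine hle.trans ?_
    rw [sub_self, norm_zero, mul_zero, zero_add, ← mul_assoc, ← mul_assoc,
      mul_right_comm _ ‖y - y'‖]
    exact mul_le_mul_of_nonneg_right (mul_le_mul_of_nonneg_right
      (sqrt_max_one_mul_div_le hc hcC hk) (abs_nonneg _)) (norm_nonneg _)
  refine ⟨hx, hy, fun x x' y y' => ?_⟩
  have hM : 1 ≤ max C (1 / c) := by
    rcases le_total 1 C with h | h
    · exact h.trans (le_max_left _ _)
    · exact ((one_le_div hc).2 (hcC.trans h)).trans (le_max_right _ _)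
  have hratio : 0 ≤ C / c - 1 := sub_nonneg.2 ((one_le_div hc).2 hcC)
  have hexp : |Real.exp (-s / 2) - Real.exp (-t / 2)| ≤ 1 := by
    have hle : ∀ {r : ℝ}, r ∈ Ici (0 : ℝ) → Real.exp (-r / 2) ≤ 1 := fun hr =>
      Real.exp_le_one_iff.2 (by linarith [mem_Ici.1 hr])
    rw [abs_le]
    constructor <;> linarith [hle hs, hle ht, Real.exp_pos (-s / 2), Real.exp_pos (-t / 2)]
  have hCc : C / c ≤ max C (1 / c) ^ 2 := by
    rw [div_eq_mul_one_div, sq]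
    gcongr
    · exact le_max_left _ _
    · exact le_max_right _ _
  have hM2 : 0 ≤ max C (1 / c) ^ 2 - 1 := sub_nonneg.2 (one_le_pow₀ hM)
  have hconst : (C / c - 1) * max C (1 / C) ^ ((3 : ℝ) / 2) *
      |Real.exp (-s / 2) - Real.exp (-t / 2)| ≤
        (max C (1 / c) ^ 2 - 1) * max C (1 / c) ^ ((3 : ℝ) / 2) := by
    refine (mul_le_of_le_one_right (by positivity) hexp).trans ?_
    gcongr
  calc ‖Ft s t x y - Ft s t x' y'‖
      ≤ ‖Ft s t x y - Ft s t x' y‖ + ‖Ft s t x' y - Ft s t x' y'‖ :=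
        norm_sub_le_norm_sub_add_norm_sub _ _ _
    _ ≤ √(max C (1 / c)) * ‖x - x'‖ +
        (max C (1 / c) ^ 2 - 1) * max C (1 / c) ^ ((3 : ℝ) / 2) * ‖y - y'‖ :=
      add_le_add (hx y x x')
        ((hy x' y y').trans (mul_le_mul_of_nonneg_right hconst (norm_nonneg _)))
    _ ≤ _ := add_le_rpow_mul_sqrt hM
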